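/- Let E be a finite homogeneous effect algebra such that S(E) = {0, 1}, and let a_i, a_j be atoms of E. If n ≥ 1, the element n·a_i = a_i ⊕ ⋯ ⊕ a_i (n times) is well defined, and n·a_i ∈ [a_j, a_j'], then a_i = a_j. -/

import Mathlib

namespace EffectAlgebraPaper

/-- An effect algebra: a set with 0, 1 and a partially defined sum `add`,
whose domain is the relation `Orth` (written `a ⊥ b` in the paper). -/
class EffectAlgebra (E : Type*) where
  zero : E
  one : E
  /-- `Orth a b` means `a ⊕ b` is defined. -/
  Orth : E → E → Prop
  /-- The sum `a ⊕ b`, meaningful only when `Orth a b`. -/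
  add : E → E → E
  orth_comm : ∀ a b : E, Orth a b → Orth b a
  add_comm : ∀ a b : E, Orth a b → add a b = add b a
  assoc : ∀ a b c : E, Orth b c → Orth a (add b c) →
    Orth a b ∧ Orth (add a b) c ∧ add a (add b c) = add (add a b) c
  compl_exists : ∀ a : E, ∃! b : E, Orth a b ∧ add a b = one
  orth_one : ∀ a : E, Orth a one → a = zero

namespace EffectAlgebra

variable {E : Type*} [EffectAlgebra E]

/-- The orthosupplement `a'`. -/
noncomputable def compl (a : E) : E := (compl_exists a).exists.choose

/-- The effect-algebra partial order: `a ≤ b` iff `a ⊕ c = b` for some `c`. -/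
def le (a b : E) : Prop := ∃ c : E, Orth a c ∧ add a c = b

/-- The interval `[x, y] = {z : x ≤ z ≤ y}`. -/
def Interval (x y : E) : Set E := { z : E | le x z ∧ le z y }

/-- An atom: a minimal nonzero element. -/
def Atom (a : E) : Prop := a ≠ zero ∧ ∀ b : E, b ≠ zero → le b a → b = a

/-- A sharp element: the only common lower bound of `x` and `x'` is `0`. -/
def Sharp (x : E) : Prop := ∀ b : E, le b x → le b (compl x) → b = zero

/-- `S(E)`, the set of sharp elements. -/
def sharpSet (E : Type*) [EffectAlgebra E] : Set E := { x : E | Sharp x }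

/-- Homogeneity: `u ≤ v₁ ⊕ v₂ ≤ u'` implies `u = u₁ ⊕ u₂` with `u₁ ≤ v₁`, `u₂ ≤ v₂`. -/
def Homogeneous (E : Type*) [EffectAlgebra E] : Prop :=
  ∀ u v₁ v₂ : E, Orth v₁ v₂ → le u (add v₁ v₂) → le (add v₁ v₂) (compl u) →
    ∃ u₁ u₂ : E, le u₁ v₁ ∧ le u₂ v₂ ∧ Orth u₁ u₂ ∧ add u₁ u₂ = u

/-- `nmul n a` is the iterated sum `n·a = a ⊕ ⋯ ⊕ a` (`n` times), with `0·a = 0`;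
it is meaningful only when `nmulDef n a` holds. -/
def nmul : ℕ → E → E
  | 0, _ => zero
  | n + 1, a => add (nmul n a) a

/-- `nmulDef n a` says the iterated sum `n·a` is well defined. -/
def nmulDef : ℕ → E → Prop
  | 0, _ => True
  | n + 1, a => nmulDef n a ∧ Orth (nmul n a) a

end EffectAlgebra

open EffectAlgebra

namespace EffectAlgebra

theorem one_orth_zero {E : Type*} [EffectAlgebra E] :
    Orth (one : E) zero ∧ add (one : E) zero = one := by
  obtain ⟨c, ⟨hc, hc1⟩, -⟩ := compl_exists (one : E)
  obtain rfl := orth_one c (orth_comm _ _ hc)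
  exact ⟨hc, hc1⟩

theorem zero_add {E : Type*} [EffectAlgebra E] (x : E) : add zero x = x := by
  obtain ⟨y, ⟨hxy, hxy1⟩, -⟩ := compl_exists x
  have h1 := one_orth_zero (E := E)
  have h0 : Orth zero (add x y) := hxy1 ▸ orth_comm _ _ h1.1
  obtain ⟨-, h2, h3⟩ := assoc zero x y hxy h0
  rw [hxy1, ← add_comm _ _ h1.1, h1.2] at h3
  exact (compl_exists y).unique
    ⟨orth_comm _ _ h2, (add_comm _ _ h2).symm.trans h3.symm⟩
    ⟨orth_comm _ _ hxy, (add_comm _ _ hxy).symm.trans hxy1⟩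

theorem le_trans {E : Type*} [EffectAlgebra E] {a b c : E} (hab : le a b) (hbc : le b c) :
    le a c := by
  obtain ⟨d, hd, rfl⟩ := hab
  obtain ⟨e, he, rfl⟩ := hbc
  rw [add_comm _ _ hd] at he ⊢
  obtain ⟨-, h, heq⟩ := assoc e d a (orth_comm _ _ hd) (orth_comm _ _ he)
  refine ⟨add e d, orth_comm _ _ h, ?_⟩
  rw [add_comm _ _ he, heq, add_comm _ _ h]

theorem eq_zero_of_le_zero {E : Type*} [EffectAlgebra E] {a : E} (h : le a zero) : a = zero := by
  obtain ⟨c, hc, hc0⟩ := h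
  have h1 := (one_orth_zero (E := E)).1
  rw [← hc0] at h1
  exact orth_one a (orth_comm _ _ (assoc one a c hc h1).1)

/-- An atom `b` with `b ≤ n·a ≤ b'`, where `a` is an atom, equals `a`. -/
theorem Atom.eq_of_nmul_mem_interval {E : Type*} [EffectAlgebra E] (hhom : Homogeneous E)
    {a b : E} (ha : Atom a) (hb : Atom b) (n : ℕ) (hdef : nmulDef n a)
    (hmem : nmul n a ∈ Interval b (compl b)) : a = b := by
  induction n with
  | zero => exact absurd (eq_zero_of_le_zero hmem.1) hb.1
  | succ n ih =>
    obtain ⟨hdef, horth⟩ := hdef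
    obtain ⟨u, v, hu, hv, huv, hsum⟩ := hhom b (nmul n a) a horth hmem.1 hmem.2
    by_cases hu0 : u = zero
    · rw [hu0, zero_add] at hsum
      rw [hsum] at hv
      exact (ha.2 b hb.1 hv).symm
    · rw [hb.2 u hu0 ⟨v, huv, hsum⟩] at hu
      exact ih hdef ⟨hu, le_trans ⟨a, horth, rfl⟩ hmem.2⟩

end EffectAlgebra

/-- Lemma 5 (lem30): in a finite homogeneous effect algebra with `S(E) = {0, 1}`,
if `aᵢ, aⱼ` are atoms, `n ≥ 1`, `n·aᵢ` is well defined and `n·aᵢ ∈ [aⱼ, aⱼ']`,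
then `aᵢ = aⱼ`. -/
theorem stmt4 {E : Type*} [EffectAlgebra E] [Finite E] (hhom : Homogeneous E)
    (hS : sharpSet E = {zero, one})
    (ai aj : E) (hi : Atom ai) (hj : Atom aj)
    (n : ℕ) (hn : 1 ≤ n) (hdef : nmulDef n ai)
    (hmem : nmul n ai ∈ Interval aj (compl aj)) :
    ai = aj := by
  exact hi.eq_of_nmul_mem_interval hhom hj n hdef hmem

end EffectAlgebraPaper
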